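/- arXiv:2509.01424 — 2 statements merged into one kernel-verified Lean document; each statement's English description precedes it below -/
import Mathlib

section
/- Fix d ≥ 1, finite nonempty types 𝒳₁,…,𝒳_d, surjective maps T_i : 𝒳_i → 𝒳_{i+1} for 1 ≤ i ≤ d−1, positive reals σ₁,…,σ_d with σ̄_i := σ₁+⋯+σ_i, a loss L : 𝒳₁ → ℝ, and λ ∈ ℝ. Define the renormalization-group iterates: Z₁ := ∑_{x∈𝒳₁} exp(−(λ/σ₁)L(x)), P¹(x) := exp(−(λ/σ₁)L(x))/Z₁, and for 1 ≤ i ≤ d−1: Uⁱ(y) := ∑_{x : T_i(x)=y} Pⁱ(x), Z_{i+1} := ∑_{y∈𝒳_{i+1}} Uⁱ(y)^{σ̄_i/σ̄_{i+1}}, P^{i+1}(y) := Uⁱ(y)^{σ̄_i/σ̄_{i+1}}/Z_{i+1}. Define P̃^{[λ]}(x) := P^d(x^{(d)}) · ∏_{i=1}^{d−1} Pⁱ(x^{(i)})/Uⁱ(x^{(i+1)}), where x^{(1)} := x and x^{(i+1)} := T_i(x^{(i)}). Then P̃^{[λ]} is a strictly positive pmf on 𝒳₁, and for every pmf P on 𝒳₁,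 with P^{(i)} and P̃^{(i)} the hierarchical pushforwards of P and of P̃^{[λ]}: ∑_{i=1}^d σ_i H(P^{(i)}) − λ ∑_x P(x)L(x) = ∑_{i=1}^d σ̄_i log Z_i − ∑_{i=1}^d σ_i D(P^{(i)} ‖ P̃^{(i)}). -/
open Finset

/-- Shannon entropy (natural log) of a pmf on a finite type, with `0 * log 0 = 0`. -/
noncomputable def entropy {α : Type*} [Fintype α] (R : α → ℝ) : ℝ :=
  -∑ x, R x * Real.log (R x)

/-- Relative entropy of finite pmfs: `D(R‖S) = ∑_{x : R x > 0} R x log (R x / S x)`. -/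
noncomputable def relEnt {α : Type*} [Fintype α] (R S : α → ℝ) : ℝ :=
  ∑ x ∈ Finset.univ.filter (fun x => 0 < R x), R x * Real.log (R x / S x)

/-- Hierarchical pushforwards: `hpush T P 0 = P` and
`hpush T P (i+1) y = ∑_{x : T i x = y} hpush T P i x`. -/
noncomputable def hpush {X : ℕ → Type*} [∀ i, Fintype (X i)] [∀ i, DecidableEq (X i)]
    (T : ∀ i, X i → X (i + 1)) (P : X 0 → ℝ) : ∀ i, X i → ℝ
  | 0 => P
  | i + 1 => fun y => ∑ x ∈ Finset.univ.filter (fun x => T i x = y), hpush T P i x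

/-- Accumulated hierarchical coefficients `σ̄_i = σ_0 + ⋯ + σ_i` (0-based). -/
noncomputable def sbar (σ : ℕ → ℝ) (i : ℕ) : ℝ := ∑ k ∈ Finset.range (i + 1), σ k

/-- The renormalization-group iterates `Pⁱ`:
`P⁰ x = exp(-(λ/σ₀) L x) / Z₀` and
`P^{i+1} y = (Uⁱ y)^{σ̄_i/σ̄_{i+1}} / Z_{i+1}`, where `Uⁱ` is the pushforward
of `Pⁱ` under `T i` and `Z`'s are the normalizing constants. -/
noncomputable def RGP {X : ℕ → Type*} [∀ i, Fintype (X i)] [∀ i, DecidableEq (X i)]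
    (T : ∀ i, X i → X (i + 1)) (σ : ℕ → ℝ) (L : X 0 → ℝ) (lam : ℝ) : ∀ i, X i → ℝ
  | 0 => fun x => Real.exp (-(lam / σ 0) * L x) / ∑ x', Real.exp (-(lam / σ 0) * L x')
  | i + 1 => fun y =>
      (∑ x ∈ Finset.univ.filter (fun x => T i x = y), RGP T σ L lam i x) ^
          (sbar σ i / sbar σ (i + 1)) /
        ∑ y', (∑ x ∈ Finset.univ.filter (fun x => T i x = y'), RGP T σ L lam i x) ^
          (sbar σ i / sbar σ (i + 1))

/-- The coarse-grained distribution `Uⁱ`, the pushforward of `Pⁱ` under `T i`. -/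
noncomputable def RGU {X : ℕ → Type*} [∀ i, Fintype (X i)] [∀ i, DecidableEq (X i)]
    (T : ∀ i, X i → X (i + 1)) (σ : ℕ → ℝ) (L : X 0 → ℝ) (lam : ℝ)
    (i : ℕ) (y : X (i + 1)) : ℝ :=
  ∑ x ∈ Finset.univ.filter (fun x => T i x = y), RGP T σ L lam i x

/-- The renormalization-group normalizing constants `Z_i`. -/
noncomputable def RGZ {X : ℕ → Type*} [∀ i, Fintype (X i)] [∀ i, DecidableEq (X i)]
    (T : ∀ i, X i → X (i + 1)) (σ : ℕ → ℝ) (L : X 0 → ℝ) (lam : ℝ) : ℕ → ℝ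
  | 0 => ∑ x, Real.exp (-(lam / σ 0) * L x)
  | i + 1 => ∑ y, RGU T σ L lam i y ^ (sbar σ i / sbar σ (i + 1))

/-- The hierarchical trajectory `x^{(i)}` of a point `x`. -/
def liftT {X : ℕ → Type*} (T : ∀ i, X i → X (i + 1)) : ∀ i, X 0 → X i
  | 0 => id
  | i + 1 => fun x => T i (liftT T i x)

/-- The distribution `P̃^{[λ]}`, obtained by disintegration:
`P̃^{[λ]}(x) = P^{d-1}(x^{(d-1)}) ∏_{i<d-1} Pⁱ(x^{(i)}) / Uⁱ(x^{(i+1)})`. -/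
noncomputable def Ptilde {X : ℕ → Type*} [∀ i, Fintype (X i)] [∀ i, DecidableEq (X i)]
    (T : ∀ i, X i → X (i + 1)) (σ : ℕ → ℝ) (L : X 0 → ℝ) (lam : ℝ)
    (d : ℕ) (x : X 0) : ℝ :=
  RGP T σ L lam (d - 1) (liftT T (d - 1) x) *
    ∏ i ∈ Finset.range (d - 1),
      (RGP T σ L lam i (liftT T i x) / RGU T σ L lam i (liftT T (i + 1) x))

lemma sum_fiber_pushforward {α β : Type*} [Fintype α] [Fintype β] [DecidableEq β]
    (T : α → β) (p : α → ℝ) (f : β → ℝ) :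
    ∑ y, (∑ x ∈ univ.filter (fun x => T x = y), p x) * f y = ∑ x, p x * f (T x) := by
  rw [← sum_fiberwise univ T (fun x => p x * f (T x))]
  refine sum_congr rfl fun y _ => ?_
  rw [sum_mul]
  refine sum_congr rfl fun x hx => ?_
  rw [(mem_filter.mp hx).2]

lemma entropy_add_relEnt {α : Type*} [Fintype α] {R S : α → ℝ}
    (hR : ∀ x, 0 ≤ R x) (hS : ∀ x, 0 < S x) :
    entropy R + relEnt R S = -∑ x, R x * Real.log (S x) := by
  have h : relEnt R S = ∑ x, R x * Real.log (R x / S x) :=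
    sum_filter_of_ne fun x _ hx =>
      (hR x).lt_of_ne' (left_ne_zero_of_mul hx)
  rw [h, entropy, neg_add_eq_iff_eq_add, ← sub_eq_add_neg, ← sum_sub_distrib]
  refine sum_congr rfl fun x _ => ?_
  rcases (hR x).eq_or_lt with h0 | h0
  · simp [← h0]
  · rw [Real.log_div h0.ne' (hS x).ne']
    ring

lemma sbar_succ (σ : ℕ → ℝ) (i : ℕ) : sbar σ (i + 1) = sbar σ i + σ (i + 1) :=
  sum_range_succ σ (i + 1)

lemma sbar_pos {σ : ℕ → ℝ} {i : ℕ} (h : ∀ k ≤ i, 0 < σ k) : 0 < sbar σ i :=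
  sum_pos (fun k hk => h k (Nat.lt_succ_iff.mp (mem_range.mp hk))) (by simp)

/-- Summation by parts along the hierarchy: `ℓ`, `p`, `u`, `z` stand for the expectations of the
log-densities of the pushforwards, of `Pⁱ`, of `Uⁱ`, and for `log Z_i`. -/
lemma sum_mul_eq_of_hierarchical_recursion (σ ℓ p u z : ℕ → ℝ) (c : ℝ) (n : ℕ)
    (hℓ : ∀ i < n, ℓ i = p i - u i + ℓ (i + 1))
    (hp : ∀ i < n, sbar σ (i + 1) * p (i + 1) = sbar σ i * u i - sbar σ (i + 1) * z (i + 1))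
    (h0 : σ 0 * p 0 = -c - σ 0 * z 0) :
    ∑ i ∈ range (n + 1), σ i * ℓ i =
      sbar σ n * (ℓ n - p n) - c - ∑ i ∈ range (n + 1), sbar σ i * z i := by
  induction n with
  | zero => simp [sbar]; linarith
  | succ m ih =>
    rw [sum_range_succ, ih (fun i hi => hℓ i (by omega)) (fun i hi => hp i (by omega)),
      sum_range_succ _ (m + 1), hℓ m (by omega)]
    linear_combination ℓ (m + 1) * (-sbar_succ σ m) + hp m (by omega)

section RenormalizationGroup

variable {X : ℕ → Type*} [∀ i, Fintype (X i)] [∀ i, DecidableEq (X i)]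
  (T : ∀ i, X i → X (i + 1)) (σ : ℕ → ℝ) (L : X 0 → ℝ) (lam : ℝ)

lemma sum_hpush_succ_mul (P : X 0 → ℝ) (i : ℕ) (f : X (i + 1) → ℝ) :
    ∑ y, hpush T P (i + 1) y * f y = ∑ x, hpush T P i x * f (T i x) :=
  sum_fiber_pushforward (T i) (hpush T P i) f

lemma hpush_nonneg {P : X 0 → ℝ} (hP : ∀ x, 0 ≤ P x) : ∀ i x, 0 ≤ hpush T P i x
  | 0, x => hP x
  | i + 1, _ => sum_nonneg fun x _ => hpush_nonneg hP i x

lemma sum_hpush (P : X 0 → ℝ) : ∀ i, ∑ x, hpush T P i x = ∑ x, P x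
  | 0 => rfl
  | i + 1 => by
    have h := sum_hpush_succ_mul T P i (fun _ => 1)
    simp only [mul_one] at h
    rw [h, sum_hpush P i]

lemma RGP_succ (i : ℕ) (y : X (i + 1)) :
    RGP T σ L lam (i + 1) y =
      RGU T σ L lam i y ^ (sbar σ i / sbar σ (i + 1)) / RGZ T σ L lam (i + 1) := rfl

variable {T σ L lam}

lemma RGU_pos {i : ℕ} (hT : Function.Surjective (T i)) (h : ∀ x, 0 < RGP T σ L lam i x)
    (y : X (i + 1)) : 0 < RGU T σ L lam i y := by
  obtain ⟨x, hx⟩ := hT y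
  exact sum_pos (fun x _ => h x) ⟨x, by simpa using hx⟩

variable (T σ L lam)

/-- The disintegration `Pⁱ(x) / Uⁱ(T x) ⋯ P^{i+k}(T^k x)` at level `i`, over `k` further levels. -/
noncomputable def RGtail : ℕ → ∀ i, X i → ℝ
  | 0, i, x => RGP T σ L lam i x
  | k + 1, i, x =>
      RGP T σ L lam i x / RGU T σ L lam i (T i x) * RGtail k (i + 1) (T i x)

lemma RGtail_liftT_mul_prod (x : X 0) (n : ℕ) : ∀ k i, i + k = n →
    RGtail T σ L lam k i (liftT T i x) * ∏ j ∈ range i,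
        (RGP T σ L lam j (liftT T j x) / RGU T σ L lam j (liftT T (j + 1) x)) =
      RGP T σ L lam n (liftT T n x) * ∏ j ∈ range n,
        (RGP T σ L lam j (liftT T j x) / RGU T σ L lam j (liftT T (j + 1) x)) := by
  intro k
  induction k with
  | zero => rintro i rfl; rfl
  | succ k ih =>
    intro i hi
    rw [← ih (i + 1) (by omega), prod_range_succ]
    simp only [RGtail, liftT]
    ring

lemma Ptilde_eq_RGtail (n : ℕ) : Ptilde T σ L lam (n + 1) = RGtail T σ L lam n 0 := by
  funext x
  have h := RGtail_liftT_mul_prod T σ L lam x n n 0 (zero_add n)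
  rw [range_zero, prod_empty, mul_one] at h
  exact h.symm

variable {T σ L lam}

lemma sum_fiber_RGtail_succ {k i : ℕ} {y : X (i + 1)} (h : 0 < RGU T σ L lam i y) :
    ∑ x ∈ univ.filter (fun x => T i x = y), RGtail T σ L lam (k + 1) i x =
      RGtail T σ L lam k (i + 1) y := by
  have h1 : ∀ x ∈ univ.filter (fun x => T i x = y), RGtail T σ L lam (k + 1) i x =
      RGP T σ L lam i x * (RGtail T σ L lam k (i + 1) y / RGU T σ L lam i y) := by
    intro x hx
    rw [RGtail, (mem_filter.mp hx).2]
    ring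
  rw [sum_congr rfl h1, ← sum_mul]
  exact mul_div_cancel₀ _ h.ne'

lemma hpush_RGtail {n : ℕ} (hU : ∀ i < n, ∀ y, 0 < RGU T σ L lam i y) :
    ∀ i k, i + k = n → hpush T (RGtail T σ L lam n 0) i = RGtail T σ L lam k i := by
  intro i
  induction i with
  | zero => rintro k hk; rw [zero_add] at hk; subst hk; rfl
  | succ i ih =>
    intro k hk
    funext y
    rw [hpush, ih (k + 1) (by omega)]
    exact sum_fiber_RGtail_succ (hU i (by omega) y)

lemma RGtail_pos {n : ℕ} (hP : ∀ i ≤ n, ∀ x, 0 < RGP T σ L lam i x)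
    (hU : ∀ i < n, ∀ y, 0 < RGU T σ L lam i y) :
    ∀ k i, i + k = n → ∀ x, 0 < RGtail T σ L lam k i x := by
  intro k
  induction k with
  | zero => intro i hi x; exact hP i (by omega) x
  | succ k ih =>
    intro i hi x
    exact mul_pos (div_pos (hP i (by omega) x) (hU i (by omega) _)) (ih (i + 1) (by omega) _)

variable [∀ i, Nonempty (X i)]

lemma RGZ_succ_pos {i : ℕ} (h : ∀ y, 0 < RGU T σ L lam i y) : 0 < RGZ T σ L lam (i + 1) :=
  sum_pos (fun y _ => Real.rpow_pos_of_pos (h y) _) univ_nonempty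

lemma RGZ_zero_pos : 0 < RGZ T σ L lam 0 :=
  sum_pos (fun _ _ => Real.exp_pos _) univ_nonempty

lemma RGP_pos {n : ℕ} (hT : ∀ i < n, Function.Surjective (T i)) :
    ∀ i ≤ n, ∀ x, 0 < RGP T σ L lam i x := by
  intro i
  induction i with
  | zero => intro _ x; exact div_pos (Real.exp_pos _) (RGZ_zero_pos (T := T) (σ := σ))
  | succ i ih =>
    intro hi x
    have hU := RGU_pos (hT i (by omega)) (ih (by omega))
    exact div_pos (Real.rpow_pos_of_pos (hU x) _) (RGZ_succ_pos hU)

lemma sum_RGP {n : ℕ} (hU : ∀ i < n, ∀ y, 0 < RGU T σ L lam i y) :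
    ∑ x, RGP T σ L lam n x = 1 := by
  cases n with
  | zero =>
    simp only [RGP]
    rw [← sum_div]
    exact div_self (RGZ_zero_pos (T := T) (σ := σ)).ne'
  | succ m =>
    simp only [RGP_succ]
    rw [← sum_div]
    exact div_self (RGZ_succ_pos (hU m (by omega))).ne'

lemma log_RGP_zero (hσ : σ 0 ≠ 0) (x : X 0) :
    σ 0 * Real.log (RGP T σ L lam 0 x) = -(lam * L x) - σ 0 * Real.log (RGZ T σ L lam 0) := by
  have h : RGP T σ L lam 0 x = Real.exp (-(lam / σ 0) * L x) / RGZ T σ L lam 0 := rfl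
  rw [h, Real.log_div (Real.exp_pos _).ne' RGZ_zero_pos.ne', Real.log_exp]
  field_simp

lemma log_RGP_succ {i : ℕ} (hσ : sbar σ (i + 1) ≠ 0) (hU : ∀ y, 0 < RGU T σ L lam i y)
    (y : X (i + 1)) :
    sbar σ (i + 1) * Real.log (RGP T σ L lam (i + 1) y) =
      sbar σ i * Real.log (RGU T σ L lam i y) -
        sbar σ (i + 1) * Real.log (RGZ T σ L lam (i + 1)) := by
  rw [RGP_succ, Real.log_div (Real.rpow_pos_of_pos (hU y) _).ne' (RGZ_succ_pos hU).ne',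
    Real.log_rpow (hU y)]
  field_simp

end RenormalizationGroup

/-- Hierarchical Gibbs variational principle (discrete case): `P̃^{[λ]}` is a
strictly positive pmf and, for every pmf `P` on `X 0`,
`H_{(σ,T)}(P) - λ E_P[L] = ∑ σ̄_i log Z_i - D_{(σ,T)}(P ‖ P̃^{[λ]})`. -/
theorem stmt_6 (d : ℕ) (hd : 1 ≤ d) (X : ℕ → Type*) [∀ i, Fintype (X i)]
    [∀ i, Nonempty (X i)] [∀ i, DecidableEq (X i)]
    (T : ∀ i, X i → X (i + 1)) (hT : ∀ i, i < d - 1 → Function.Surjective (T i))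
    (σ : ℕ → ℝ) (hσ : ∀ i, i < d → 0 < σ i) (L : X 0 → ℝ) (lam : ℝ) :
    (∀ x, 0 < Ptilde T σ L lam d x) ∧
    (∑ x, Ptilde T σ L lam d x = 1) ∧
    ∀ P : X 0 → ℝ, (∀ x, 0 ≤ P x) → (∑ x, P x = 1) →
      ∑ i ∈ Finset.range d, σ i * entropy (hpush T P i) - lam * ∑ x, P x * L x =
        ∑ i ∈ Finset.range d, sbar σ i * Real.log (RGZ T σ L lam i) -
          ∑ i ∈ Finset.range d,
            σ i * relEnt (hpush T P i) (hpush T (Ptilde T σ L lam d) i) := by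
  obtain ⟨n, rfl⟩ : ∃ n, d = n + 1 := ⟨d - 1, by omega⟩
  rw [Nat.add_sub_cancel] at hT
  have hRGP : ∀ i ≤ n, ∀ x, 0 < RGP T σ L lam i x := RGP_pos hT
  have hU : ∀ i < n, ∀ y, 0 < RGU T σ L lam i y := fun i hi =>
    RGU_pos (hT i hi) (hRGP i hi.le)
  have htail := RGtail_pos hRGP hU
  have hpush_tail := hpush_RGtail hU
  rw [Ptilde_eq_RGtail]
  refine ⟨htail n 0 (zero_add n), ?_, fun P hP hP1 => ?_⟩
  · rw [← sum_hpush T _ n, hpush_tail n 0 (add_zero n)]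
    exact sum_RGP hU
  have hsbar : ∀ i ≤ n, 0 < sbar σ i := fun i hi => sbar_pos fun k hk => hσ k (by omega)
  have key := sum_mul_eq_of_hierarchical_recursion σ
    (fun i => ∑ x, hpush T P i x * Real.log (hpush T (RGtail T σ L lam n 0) i x))
    (fun i => ∑ x, hpush T P i x * Real.log (RGP T σ L lam i x))
    (fun i => ∑ y, hpush T P (i + 1) y * Real.log (RGU T σ L lam i y))
    (fun i => Real.log (RGZ T σ L lam i)) (lam * ∑ x, P x * L x) n ?_ ?_ ?_
  · rw [hpush_tail n 0 (add_zero n)] at key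
    have hsplit : ∀ i ∈ range (n + 1), σ i * entropy (hpush T P i) =
        -(σ i * ∑ x, hpush T P i x * Real.log (hpush T (RGtail T σ L lam n 0) i x)) -
          σ i * relEnt (hpush T P i) (hpush T (RGtail T σ L lam n 0) i) := by
      intro i hi
      have hin : i + (n - i) = n := by have := mem_range.mp hi; omega
      have h := entropy_add_relEnt (S := hpush T (RGtail T σ L lam n 0) i)
        (hpush_nonneg T hP i) (by rw [hpush_tail i _ hin]; exact htail _ i hin)
      linear_combination σ i * h
    rw [sum_congr rfl hsplit, sum_sub_distrib, sum_neg_distrib, key]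
    simp only [RGtail]
    ring
  · intro i hi
    rw [hpush_tail i (n - (i + 1) + 1) (by omega), hpush_tail (i + 1) (n - (i + 1)) (by omega),
      sum_hpush_succ_mul, sum_hpush_succ_mul, ← sum_sub_distrib, ← sum_add_distrib]
    refine sum_congr rfl fun x _ => ?_
    have hp := hRGP i hi.le x
    have hu := hU i hi (T i x)
    rw [RGtail, Real.log_mul (div_pos hp hu).ne' (htail _ (i + 1) (by omega) _).ne',
      Real.log_div hp.ne' hu.ne']
    ring
  · intro i hi
    have h1 : ∑ y, hpush T P (i + 1) y = 1 := (sum_hpush T P (i + 1)).trans hP1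
    rw [mul_sum, mul_sum, ← mul_one (sbar σ (i + 1) * Real.log _), ← h1, mul_sum,
      ← sum_sub_distrib]
    refine sum_congr rfl fun y _ => ?_
    linear_combination hpush T P (i + 1) y * log_RGP_succ (hsbar (i + 1) hi).ne' (hU i hi) y
  · rw [mul_sum, mul_sum, ← mul_one (σ 0 * Real.log _), ← hP1, mul_sum, ← sum_neg_distrib,
      ← sum_sub_distrib]
    refine sum_congr rfl fun x _ => ?_
    rw [hpush]
    linear_combination P x * log_RGP_zero (T := T) (L := L) (lam := lam) (hσ 0 hd).ne' x
end

section
/- Let k ≥ 1, i ≥ 2, and let A, B be k×k real matrices with A symmetric. Suppose the (ik)×(ik) block Toeplitz matrix M := 𝒯_i[A,B] is positive definite, and set A′ := A − BᵀA⁻¹B and B′ := B − BᵀA⁻¹B. Then A is positive definite, and for every x ∈ ℝ^{(i−1)k}, ∫_{ℝ^k} exp(−(x,y)ᵀ M (x,y)) dy = π^{k/2} (det A)^{−1/2} · exp(−xᵀ 𝒯_{i−1}[A′,B′] x), where (x,y) ∈ ℝ^{ik} denotes the concatenation of x with y in the last block of coordinates and the integral is with respect to Lebesgue measure on ℝ^k.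 -/
open Matrix MeasureTheory

/-- The block Toeplitz matrix `𝒯_i[A,B]`: the `(a,b)` block (of size `k×k`)
equals `A` if `a = b`, `Bᵀ` if `a < b`, and `B` if `a > b`. -/
def blockToeplitz (k i : ℕ) (A B : Matrix (Fin k) (Fin k) ℝ) :
    Matrix (Fin i × Fin k) (Fin i × Fin k) ℝ :=
  Matrix.of fun p q =>
    if p.1 = q.1 then A p.2 q.2
    else if (p.1 : ℕ) < (q.1 : ℕ) then Bᵀ p.2 q.2
    else B p.2 q.2

/-- Concatenation of `x ∈ ℝ^{(i-1)k}` with `y ∈ ℝ^k` placed in the last block. -/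
def blockConcat (k i : ℕ) (x : Fin (i - 1) × Fin k → ℝ) (y : Fin k → ℝ) :
    Fin i × Fin k → ℝ :=
  fun p => if h : (p.1 : ℕ) < i - 1 then x (⟨p.1.1, h⟩, p.2) else y p.2

section GaussianIntegral

variable {m n : Type*} [Fintype m] [Fintype n]

theorem integral_exp_neg_dotProduct_self :
    ∫ y : n → ℝ, Real.exp (-(y ⬝ᵥ y)) = Real.pi ^ ((Fintype.card n : ℝ) / 2) := by
  have h (y : n → ℝ) : Real.exp (-(y ⬝ᵥ y)) = ∏ j, Real.exp (-1 * y j ^ 2) := by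
    rw [← Real.exp_sum, dotProduct, ← Finset.sum_neg_distrib]
    congr! 2 with j
    ring
  simp_rw [h]
  rw [integral_fintype_prod_volume_eq_pow (fun t : ℝ => Real.exp (-1 * t ^ 2)),
    integral_gaussian, div_one, Real.sqrt_eq_rpow, ← Real.rpow_natCast,
    ← Real.rpow_mul Real.pi_pos.le]
  congr 1
  ring

variable [DecidableEq n]

open scoped MatrixOrder Matrix.Norms.L2Operator in
theorem Matrix.PosDef.exists_eq_transpose_mul_self {A : Matrix n n ℝ} (hA : A.PosDef) :
    ∃ C : Matrix n n ℝ, C.det ≠ 0 ∧ A = Cᵀ * C := by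
  obtain ⟨C, hC⟩ := CStarAlgebra.nonneg_iff_eq_star_mul_self.mp hA.posSemidef.nonneg
  rw [star_eq_conjTranspose, conjTranspose_eq_transpose_of_trivial] at hC
  refine ⟨C, fun h => hA.det_pos.ne' ?_, hC⟩
  rw [hC, det_mul, h, mul_zero]

theorem integral_comp_mulVec {C : Matrix n n ℝ} (hC : C.det ≠ 0) (f : (n → ℝ) → ℝ) :
    ∫ y, f (C *ᵥ y) = |C.det|⁻¹ * ∫ y, f y := by
  have he : MeasurableEmbedding (toLin' C) :=
    (LinearEquiv.toContinuousLinearEquiv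
      (LinearEquiv.ofIsUnitDet (f := toLin' C) (v := Pi.basisFun ℝ n) (v' := Pi.basisFun ℝ n)
        (by simpa [LinearMap.toMatrix_eq_toMatrix'] using hC))).toHomeomorph.measurableEmbedding
  have h := he.integral_map (μ := volume) f
  rw [Real.map_matrix_volume_pi_eq_smul_volume_pi hC, integral_smul_measure,
    ENNReal.toReal_ofReal (abs_nonneg _), abs_inv, smul_eq_mul] at h
  simpa using h.symm

theorem Matrix.PosDef.integral_exp_neg {A : Matrix n n ℝ} (hA : A.PosDef) :
    ∫ y : n → ℝ, Real.exp (-(y ⬝ᵥ A *ᵥ y)) =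
      Real.pi ^ ((Fintype.card n : ℝ) / 2) * A.det ^ (-(1 : ℝ) / 2) := by
  obtain ⟨C, hC, rfl⟩ := hA.exists_eq_transpose_mul_self
  have h (y : n → ℝ) : y ⬝ᵥ (Cᵀ * C) *ᵥ y = (C *ᵥ y) ⬝ᵥ (C *ᵥ y) := by
    rw [← mulVec_mulVec, dotProduct_mulVec, vecMul_transpose]
  simp_rw [h]
  rw [integral_comp_mulVec hC (fun y => Real.exp (-(y ⬝ᵥ y))), integral_exp_neg_dotProduct_self,
    mul_comm, det_mul, det_transpose, ← sq, neg_div, Real.rpow_neg (sq_nonneg _),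
    ← Real.sqrt_eq_rpow, Real.sqrt_sq_eq_abs]

/-- Integrating out the second block of a Gaussian density leaves the Gaussian density of the
Schur complement. -/
theorem integral_exp_neg_fromBlocks (P : Matrix m m ℝ) (U : Matrix m n ℝ)
    {D : Matrix n n ℝ} (hD : D.PosDef) (x : m → ℝ) :
    ∫ y : n → ℝ, Real.exp (-(Sum.elim x y ⬝ᵥ fromBlocks P U Uᵀ D *ᵥ Sum.elim x y)) =
      Real.pi ^ ((Fintype.card n : ℝ) / 2) * D.det ^ (-(1 : ℝ) / 2) *
        Real.exp (-(x ⬝ᵥ (P - U * D⁻¹ * Uᵀ) *ᵥ x)) := by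
  have : Invertible D := hD.isUnit.invertible
  have h (y : n → ℝ) : Real.exp (-(Sum.elim x y ⬝ᵥ fromBlocks P U Uᵀ D *ᵥ Sum.elim x y)) =
      Real.exp (-((y + (D⁻¹ * Uᵀ) *ᵥ x) ⬝ᵥ D *ᵥ (y + (D⁻¹ * Uᵀ) *ᵥ x))) *
        Real.exp (-(x ⬝ᵥ (P - U * D⁻¹ * Uᵀ) *ᵥ x)) := by
    have hs := schur_complement_eq₂₂ P U x y hD.isHermitian
    simp only [star_trivial, conjTranspose_eq_transpose_of_trivial, ← dotProduct_mulVec] at hs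
    rw [← Real.exp_add, ← neg_add, hs, add_comm y]
  simp_rw [h]
  rw [integral_mul_const,
    integral_add_right_eq_self (fun y : n → ℝ => Real.exp (-(y ⬝ᵥ D *ᵥ y))), hD.integral_exp_neg]

end GaussianIntegral

section BlockToeplitz

variable {k n : ℕ}

/-- The splitting of `n + 1` blocks of size `k` into the first `n` blocks and the last one. -/
def lastBlockEquiv (k n : ℕ) : (Fin n × Fin k) ⊕ Fin k ≃ Fin (n + 1) × Fin k :=
  ((Equiv.sumCongr (Equiv.refl _) (Equiv.uniqueProd (Fin k) (Fin 1)).symm).trans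
    (Equiv.sumProdDistrib _ _ _).symm).trans (finSumFinEquiv.prodCongr (Equiv.refl _))

@[simp]
theorem lastBlockEquiv_inl (p : Fin n × Fin k) :
    lastBlockEquiv k n (Sum.inl p) = (p.1.castSucc, p.2) := rfl

@[simp]
theorem lastBlockEquiv_inr (j : Fin k) : lastBlockEquiv k n (Sum.inr j) = (Fin.last n, j) := rfl

theorem blockConcat_comp_lastBlockEquiv (x : Fin n × Fin k → ℝ) (y : Fin k → ℝ) :
    blockConcat k (n + 1) x y ∘ lastBlockEquiv k n = Sum.elim x y := by
  ext (p | j) <;> simp [blockConcat]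

/-- The blocks of `𝒯_{n+1}[A,B]` in its last column, the diagonal one excepted. -/
def lastBlockColumn (k n : ℕ) (B : Matrix (Fin k) (Fin k) ℝ) :
    Matrix (Fin n × Fin k) (Fin k) ℝ :=
  Matrix.of fun p j => B j p.2

theorem blockToeplitz_submatrix_lastBlockEquiv (A B : Matrix (Fin k) (Fin k) ℝ) :
    (blockToeplitz k (n + 1) A B).submatrix (lastBlockEquiv k n) (lastBlockEquiv k n) =
      fromBlocks (blockToeplitz k n A B) (lastBlockColumn k n B) (lastBlockColumn k n B)ᵀ A := by
  ext (p | j) (q | l)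
  · simp [blockToeplitz]
  · simp [blockToeplitz, lastBlockColumn, Fin.castSucc_ne_last]
  · simp [blockToeplitz, lastBlockColumn, (Fin.castSucc_ne_last _).symm,
      (Fin.castSucc_lt_last q.1).not_gt]
  · simp [blockToeplitz]

theorem blockToeplitz_sub_lastBlockColumn {A : Matrix (Fin k) (Fin k) ℝ} (hA : A.IsSymm)
    (B : Matrix (Fin k) (Fin k) ℝ) :
    blockToeplitz k n A B - lastBlockColumn k n B * A⁻¹ * (lastBlockColumn k n B)ᵀ =
      blockToeplitz k n (A - Bᵀ * A⁻¹ * B) (B - Bᵀ * A⁻¹ * B) := by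
  have hs : (Bᵀ * A⁻¹ * B)ᵀ = Bᵀ * A⁻¹ * B := by
    rw [transpose_mul, transpose_mul, transpose_transpose, transpose_nonsing_inv, hA.eq,
      Matrix.mul_assoc]
  have hp : lastBlockColumn k n B * A⁻¹ * (lastBlockColumn k n B)ᵀ =
      (Bᵀ * A⁻¹ * B).submatrix Prod.snd Prod.snd := rfl
  ext p q
  have hpq := congr_fun₂ hs p.2 q.2
  rw [transpose_apply] at hpq
  rw [hp]
  simp only [blockToeplitz, Matrix.sub_apply, of_apply, submatrix_apply, transpose_apply]
  split_ifs <;> simp [hpq]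

theorem blockConcat_dotProduct_blockToeplitz_mulVec (A B : Matrix (Fin k) (Fin k) ℝ)
    (x : Fin n × Fin k → ℝ) (y : Fin k → ℝ) :
    blockConcat k (n + 1) x y ⬝ᵥ blockToeplitz k (n + 1) A B *ᵥ blockConcat k (n + 1) x y =
      Sum.elim x y ⬝ᵥ fromBlocks (blockToeplitz k n A B) (lastBlockColumn k n B)
        (lastBlockColumn k n B)ᵀ A *ᵥ Sum.elim x y := by
  rw [← blockToeplitz_submatrix_lastBlockEquiv, ← blockConcat_comp_lastBlockEquiv,
    submatrix_mulVec_equiv, Function.comp_assoc, Equiv.self_comp_symm, Function.comp_id,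
    comp_equiv_dotProduct_comp_equiv]

end BlockToeplitz

/-- Parameter flow for quadratic modular losses: integrating out the last
block of the unnormalized Gaussian density `exp(-zᵀ 𝒯_i[A,B] z)` yields
`π^{k/2} (det A)^{-1/2} exp(-xᵀ 𝒯_{i-1}[A', B'] x)` with
`A' = A - BᵀA⁻¹B` and `B' = B - BᵀA⁻¹B`. -/
theorem stmt_10 (k i : ℕ) (hk : 1 ≤ k) (hi : 2 ≤ i)
    (A B : Matrix (Fin k) (Fin k) ℝ) (hA : A.IsSymm)
    (hM : (blockToeplitz k i A B).PosDef) :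
    A.PosDef ∧
    ∀ x : Fin (i - 1) × Fin k → ℝ,
      (∫ y : Fin k → ℝ,
          Real.exp (-(blockConcat k i x y ⬝ᵥ
            (blockToeplitz k i A B).mulVec (blockConcat k i x y)))) =
        Real.pi ^ ((k : ℝ) / 2) * A.det ^ (-(1 : ℝ) / 2) *
          Real.exp (-(x ⬝ᵥ
            (blockToeplitz k (i - 1) (A - Bᵀ * A⁻¹ * B) (B - Bᵀ * A⁻¹ * B)).mulVec x)) := by
  obtain ⟨n, rfl⟩ : ∃ n, i = n + 1 := ⟨i - 1, by omega⟩
  have hpos : A.PosDef := by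
    have h := (hM.submatrix (lastBlockEquiv k n).injective).submatrix
      (Sum.inr_injective (α := Fin n × Fin k))
    rwa [blockToeplitz_submatrix_lastBlockEquiv] at h
  refine ⟨hpos, fun (x : Fin n × Fin k → ℝ) => ?_⟩
  have h := integral_exp_neg_fromBlocks (blockToeplitz k n A B) (lastBlockColumn k n B) hpos x
  simp_rw [← blockConcat_dotProduct_blockToeplitz_mulVec] at h
  rwa [blockToeplitz_sub_lastBlockColumn hA, Fintype.card_fin] at h
end
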